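/- arXiv:2411.03230 — 2 statements merged into one kernel-verified Lean document; each statement's English description precedes it below -/
import Mathlib

section
/- For the perturbation V₂, the second-order effective interaction on the encoded qubits satisfies −E† V₂ G V₂ E = (1/27)(−10·I₄ + 8·X⊗X − X⊗I₂ − I₂⊗X), for any matrix G with G = Π₊ G Π₊ and G·(Π_c H₀ Π_c)·Π₊ = Π₊. -/
open Matrix
open scoped Kronecker

noncomputable section

/-- Index type for the Fock space of 9 fermionic modes, `ℂ^512`.
Modes `i1,i2,i3,j1,j2,j3,x,y,z` are labelled `0,…,8` in this order. -/
abbrev Idx := Fin 9 → Bool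

abbrev Mat := Matrix Idx Idx ℂ

/-- Jordan–Wigner annihilation operator `a_k = Z^{⊗(k-1)} ⊗ σ⁻ ⊗ I^{⊗(9-k)}`,
written entrywise in the occupation-number basis (`false` = unoccupied `|0⟩`). -/
def a (k : Fin 9) : Mat :=
  Matrix.of fun s t =>
    if t k = true ∧ s = Function.update t k false then
      (-1 : ℂ) ^ (Finset.univ.filter fun l => l < k ∧ t l = true).card
    else 0

/-- Creation operator `a_k†`. -/
def ad (k : Fin 9) : Mat := (a k)ᴴ

/-- The vacuum state `|vac⟩ = |0⟩^{⊗9}`. -/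
def vac : Idx → ℂ := fun t => if t = (fun _ => false) then 1 else 0

/-- `√3` as a complex number. -/
def s3 : ℂ := (Real.sqrt 3 : ℝ)

/-- The edges of the constraint graph `G_c`:
`{i1,i2},{i2,i3},{i1,i3},{j1,j2},{j2,j3},{j1,j3},{i2,x},{j2,x},{i3,y},{j3,y},{i1,z},{j1,z}`. -/
def edges : Finset (Fin 9 × Fin 9) :=
  {(0,1), (1,2), (0,2), (3,4), (4,5), (3,5), (1,6), (4,6), (2,7), (5,7), (0,8), (3,8)}

/-- Adjacency in the constraint graph `G_c`. -/
def Adj (k l : Fin 9) : Prop := (k, l) ∈ edges ∨ (l, k) ∈ edges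

instance (k l : Fin 9) : Decidable (Adj k l) := by unfold Adj; infer_instance

/-- `S` is an independent set of the constraint graph `G_c`. -/
def IndepSet (S : Finset (Fin 9)) : Prop := ∀ k ∈ S, ∀ l ∈ S, ¬ Adj k l

instance (S : Finset (Fin 9)) : Decidable (IndepSet S) := by unfold IndepSet; infer_instance

/-- The Fock basis state `|S⟩` with exactly the modes in `S` occupied. -/
def fock (S : Finset (Fin 9)) : Idx → ℂ :=
  fun t => if t = (fun k => decide (k ∈ S)) then 1 else 0

/-- The set of occupied modes of an occupation vector. -/
def suppOf (t : Idx) : Finset (Fin 9) := Finset.univ.filter fun k => t k = true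

/-- The two-particle constrained subspace: the span of the Fock states `|S⟩` over
independent sets `S` of `G_c` with `|S| = 2`. -/
def C2 : Submodule ℂ (Idx → ℂ) :=
  Submodule.span ℂ {v | ∃ S : Finset (Fin 9), IndepSet S ∧ S.card = 2 ∧ v = fock S}

/-- `Π_c`, the orthogonal projector onto the two-particle constrained subspace.
Since that subspace is spanned by standard (Fock) basis vectors, the orthogonal
projector is the diagonal 0/1 matrix supported on those coordinates. -/
def Pic : Mat :=
  Matrix.diagonal fun t => if IndepSet (suppOf t) ∧ (suppOf t).card = 2 then 1 else 0

/-- `H_{0,i} = I + (a_{i1}†a_{i2}+h.c.) + (a_{i2}†a_{i3}+h.c.) + (a_{i3}†a_{i1}+h.c.)`. -/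
def H0i : Mat :=
  1 + (ad 0 * a 1 + ad 1 * a 0) + (ad 1 * a 2 + ad 2 * a 1) + (ad 2 * a 0 + ad 0 * a 2)

/-- `H_{0,j}`, defined analogously on modes `j1,j2,j3`. -/
def H0j : Mat :=
  1 + (ad 3 * a 4 + ad 4 * a 3) + (ad 4 * a 5 + ad 5 * a 4) + (ad 5 * a 3 + ad 3 * a 5)

/-- `H₀ = H_{0,i} + H_{0,j}`. -/
def H0 : Mat := H0i + H0j

/-- `S_{·,b}` on modes `k1,k2,k3`:
`S_{·,0} = (1/(2√3))((1−√3)a_{k3}† − 2a_{k1}† + (1+√3)a_{k2}†)` and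
`S_{·,1} = (1/(2√3))((1+√3)a_{k3}† − 2a_{k1}† + (1−√3)a_{k2}†)`. -/
def Senc (k1 k2 k3 : Fin 9) (b : Fin 2) : Mat :=
  if b = 0 then
    (1 / (2 * s3)) • ((1 - s3) • ad k3 - (2 : ℂ) • ad k1 + (1 + s3) • ad k2)
  else
    (1 / (2 * s3)) • ((1 + s3) • ad k3 - (2 : ℂ) • ad k1 + (1 - s3) • ad k2)

/-- The encoded two-qubit state `|bb'⟩_enc = S_{i,b} S_{j,b'} |vac⟩`. -/
def enc (b b' : Fin 2) : Idx → ℂ := (Senc 0 1 2 b * Senc 3 4 5 b').mulVec vac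

/-- The encoding isometry `E : ℂ⁴ → ℂ^512`, sending `|b⟩⊗|b'⟩` to `|bb'⟩_enc`. -/
def Eenc : Matrix Idx (Fin 2 × Fin 2) ℂ := Matrix.of fun t p => enc p.1 p.2 t

/-- `Π₋ = E E†`, the orthogonal projector onto the span of the four encoded states. -/
def Pim : Mat := Eenc * Eencᴴ

/-- `Π₊ = Π_c − Π₋`. -/
def Pip : Mat := Pic - Pim

/-- `V₁ = (a_{i2}†a_x+h.c.) + (a_{j2}†a_x+h.c.) + (a_{i3}†a_y+h.c.) + (a_{j3}†a_y+h.c.)`. -/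
def V1 : Mat :=
  (ad 1 * a 6 + ad 6 * a 1) + (ad 4 * a 6 + ad 6 * a 4)
    + (ad 2 * a 7 + ad 7 * a 2) + (ad 5 * a 7 + ad 7 * a 5)

/-- `V₂ = (a_{i1}†a_z+h.c.) + (a_{j1}†a_z+h.c.)`. -/
def V2 : Mat := (ad 0 * a 8 + ad 8 * a 0) + (ad 3 * a 8 + ad 8 * a 3)

/-- `V_main = V₁ + V₂`. -/
def Vmain : Mat := V1 + V2

/-- The Pauli matrix `X`. -/
def PX : Matrix (Fin 2) (Fin 2) ℂ := !![0, 1; 1, 0]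

/-- The Pauli matrix `Z`. -/
def PZ : Matrix (Fin 2) (Fin 2) ℂ := !![1, 0; 0, -1]

/-- The Jordan–Wigner sign of mode `k` in the occupation vector `s`. -/
def jwSign (k : Fin 9) (s : Idx) : ℂ :=
  (-1 : ℂ) ^ (Finset.univ.filter fun l => l < k ∧ s l = true).card

theorem jwSign_mul_self (k : Fin 9) (s : Idx) : jwSign k s * jwSign k s = 1 := by
  unfold jwSign
  rw [← mul_pow]
  norm_num

theorem star_jwSign (k : Fin 9) (s : Idx) : star (jwSign k s) = jwSign k s := by
  simp [jwSign]

theorem jwSign_update_of_not_lt {k l : Fin 9} (h : ¬ k < l) (s : Idx) (b : Bool) :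
    jwSign l (Function.update s k b) = jwSign l s := by
  unfold jwSign
  congr 2
  ext m
  simp only [Finset.mem_filter, Finset.mem_univ, true_and]
  refine and_congr_right fun hm => ?_
  rw [Function.update_of_ne]
  rintro rfl
  exact h hm

theorem jwSign_update_true_of_lt {k l : Fin 9} (h : k < l) {s : Idx} (hs : s k = false) :
    jwSign l (Function.update s k true) = -jwSign l s := by
  unfold jwSign
  have : (Finset.univ.filter fun m => m < l ∧ Function.update s k true m = true)
      = insert k (Finset.univ.filter fun m => m < l ∧ s m = true) := by
    ext m
    by_cases hm : m = k
    · subst hm; simp [h]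
    · simp [hm]
  rw [this, Finset.card_insert_of_notMem (by simp [hs]), pow_succ]
  ring

theorem jwSign_update_false_of_lt {k l : Fin 9} (h : k < l) {s : Idx} (hs : s k = true) :
    jwSign l (Function.update s k false) = -jwSign l s := by
  have := jwSign_update_true_of_lt h (s := Function.update s k false) (by simp)
  rw [Function.update_idem, ← hs, Function.update_eq_self] at this
  rw [this, neg_neg]

theorem a_mulVec_apply (k : Fin 9) (v : Idx → ℂ) (s : Idx) :
    (a k *ᵥ v) s = if s k = true then 0 else jwSign k s * v (Function.update s k true) := by
  simp only [mulVec, dotProduct, a, of_apply]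
  split_ifs with h
  · refine Finset.sum_eq_zero fun t _ => ?_
    rw [if_neg, zero_mul]
    rintro ⟨-, rfl⟩
    simp at h
  · rw [Finset.sum_eq_single (Function.update s k true)]
    · rw [if_pos]
      · exact congrArg (· * _) (jwSign_update_of_not_lt (lt_irrefl k) s true)
      · simp only [Bool.not_eq_true] at h
        simp [← h]
    · rintro t - ht
      rw [if_neg, zero_mul]
      rintro ⟨h1, rfl⟩
      apply ht
      simp [← h1]
    · simp

theorem ad_mulVec_apply (k : Fin 9) (v : Idx → ℂ) (s : Idx) :
    (ad k *ᵥ v) s = if s k = true then jwSign k s * v (Function.update s k false) else 0 := by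
  simp only [mulVec, dotProduct, ad, conjTranspose_apply, a, of_apply]
  split_ifs with h
  · rw [Finset.sum_eq_single (Function.update s k false)]
    · simp only [h, and_self, if_true]
      exact congrArg (· * _) (star_jwSign k s)
    · rintro t - ht
      simp [ht]
    · simp
  · simp [h]

/-- The canonical anticommutation relation between `a k` and `ad l`. -/
theorem a_mulVec_ad_mulVec (k l : Fin 9) (v : Idx → ℂ) :
    a k *ᵥ (ad l *ᵥ v) = (if k = l then v else 0) - ad l *ᵥ (a k *ᵥ v) := by
  ext s
  simp only [Pi.sub_apply, a_mulVec_apply, ad_mulVec_apply]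
  by_cases hkl : k = l
  · subst hkl
    by_cases hs : s k = true
    · simp only [hs, if_true, Function.update_self, Bool.false_eq_true, if_false,
        Function.update_idem]
      rw [jwSign_update_of_not_lt (lt_irrefl k), ← mul_assoc, jwSign_mul_self, ← hs,
        Function.update_eq_self]
      simp
    · simp only [hs, if_true, Function.update_self, Bool.false_eq_true, if_false,
        Function.update_idem]
      rw [jwSign_update_of_not_lt (lt_irrefl k), ← mul_assoc, jwSign_mul_self]
      simp only [Bool.not_eq_true] at hs
      rw [← hs, Function.update_eq_self]
      simp
  · have hlk : l ≠ k := Ne.symm hkl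
    simp only [Function.update_of_ne hlk, Function.update_of_ne hkl, if_neg hkl, Pi.zero_apply,
      zero_sub]
    by_cases hk : s k = true
    · simp [hk]
    · by_cases hl : s l = true
      · simp only [hk, hl, if_true]
        simp only [Bool.not_eq_true] at hk
        rw [Function.update_comm hkl]
        rcases lt_or_gt_of_ne hkl with h | h
        · rw [jwSign_update_true_of_lt h hk, jwSign_update_of_not_lt h.not_gt]
          simp; ring
        · rw [jwSign_update_of_not_lt h.not_gt, jwSign_update_false_of_lt h hl]
          simp; ring
      · simp [hl]

/-- The canonical anticommutation relation between `ad k` and `ad l`. -/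
theorem ad_mulVec_ad_mulVec (k l : Fin 9) (v : Idx → ℂ) :
    ad k *ᵥ (ad l *ᵥ v) = -(ad l *ᵥ (ad k *ᵥ v)) := by
  ext s
  simp only [Pi.neg_apply, ad_mulVec_apply]
  by_cases hkl : k = l
  · subst hkl
    simp
  · have hlk : l ≠ k := Ne.symm hkl
    simp only [Function.update_of_ne hlk, Function.update_of_ne hkl]
    by_cases hk : s k = true
    · by_cases hl : s l = true
      · simp only [hk, hl, if_true]
        rw [Function.update_comm hkl]
        rcases lt_or_gt_of_ne hkl with h | h
        · rw [jwSign_update_false_of_lt h hk, jwSign_update_of_not_lt h.not_gt]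
          ring
        · rw [jwSign_update_of_not_lt h.not_gt, jwSign_update_false_of_lt h hl]
          ring
      · simp [hl]
    · simp [hk]

theorem a_mulVec_vac (k : Fin 9) : a k *ᵥ vac = 0 := by
  ext s
  rw [a_mulVec_apply, vac]
  have : Function.update s k true ≠ fun _ => false := fun h => by
    simpa using congrFun h k
  simp [this]

theorem star_ad_mulVec_dotProduct (k : Fin 9) (v w : Idx → ℂ) :
    star (ad k *ᵥ v) ⬝ᵥ w = star v ⬝ᵥ (a k *ᵥ w) := by
  rw [star_mulVec, ad, conjTranspose_conjTranspose, ← dotProduct_mulVec]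

theorem star_vac_dotProduct_vac : star vac ⬝ᵥ vac = 1 := by
  simp [dotProduct, vac]

/-- The two-particle state `a_k† a_l† |vac⟩`. -/
def pairState (k l : Fin 9) : Idx → ℂ := ad k *ᵥ (ad l *ᵥ vac)

theorem pairState_swap (k l : Fin 9) : pairState k l = -pairState l k :=
  ad_mulVec_ad_mulVec k l vac

theorem a_mulVec_pairState (q k l : Fin 9) :
    a q *ᵥ pairState k l =
      (if q = k then ad l *ᵥ vac else 0) - (if q = l then ad k *ᵥ vac else 0) := by
  rw [pairState, a_mulVec_ad_mulVec, a_mulVec_ad_mulVec, a_mulVec_vac, mulVec_zero, sub_zero]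
  split_ifs <;> simp

/-- Hopping terms act as derivations on two-particle states. -/
theorem hop_mulVec_pairState (p q k l : Fin 9) :
    (ad p * a q) *ᵥ pairState k l =
      (if q = k then pairState p l else 0) + (if q = l then pairState k p else 0) := by
  rw [← mulVec_mulVec, a_mulVec_pairState, mulVec_sub, sub_eq_add_neg]
  congr 1
  · split_ifs <;> simp [pairState]
  · rw [pairState_swap k p]
    split_ifs <;> simp [pairState]

theorem star_pairState_dotProduct (k l m n : Fin 9) :
    star (pairState k l) ⬝ᵥ pairState m n =
      (if k = m ∧ l = n then 1 else 0) - (if k = n ∧ l = m then 1 else 0) := by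
  have h (p q : Fin 9) : a p *ᵥ (ad q *ᵥ vac) = if p = q then vac else 0 := by
    rw [a_mulVec_ad_mulVec, a_mulVec_vac, mulVec_zero, sub_zero]
  conv_lhs => rw [pairState]
  rw [star_ad_mulVec_dotProduct, star_ad_mulVec_dotProduct, a_mulVec_pairState, mulVec_sub,
    dotProduct_sub]
  congr 1
  · by_cases h1 : k = m <;> by_cases h2 : l = n <;> simp [h1, h2, h, star_vac_dotProduct_vac]
  · by_cases h1 : k = n <;> by_cases h2 : l = m <;> simp [h1, h2, h, star_vac_dotProduct_vac]

theorem pairState_apply_of_ne {k l : Fin 9} {s : Idx} (h : suppOf s ≠ {k, l}) :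
    pairState k l s = 0 := by
  rw [pairState, ad_mulVec_apply, ad_mulVec_apply, vac]
  split_ifs with h1 h2 h3
  · refine absurd ?_ h
    ext m
    have := congrFun h3 m
    by_cases hl : m = l
    · subst hl
      by_cases hk : m = k
      · subst hk; simp at h2
      · rw [Function.update_of_ne hk] at h2
        simp [suppOf, h2]
    · by_cases hk : m = k
      · subst hk; simp [suppOf, h1]
      · simp [suppOf, hl, hk] at this ⊢
        exact this
  all_goals simp

theorem Pic_mulVec_pairState (k l : Fin 9) :
    Pic *ᵥ pairState k l =
      if IndepSet {k, l} ∧ ({k, l} : Finset (Fin 9)).card = 2 then pairState k l else 0 := by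
  ext s
  rw [Pic, mulVec_diagonal]
  by_cases h : suppOf s = {k, l}
  · rw [h]
    split_ifs <;> simp
  · split_ifs <;> simp [pairState_apply_of_ne h]

theorem s3_mul_self : s3 * s3 = 3 := by
  rw [s3, ← Complex.ofReal_mul, Real.mul_self_sqrt (by norm_num)]
  norm_num

theorem star_s3 : star s3 = s3 := Complex.conj_ofReal _

/-- The coefficients of the creation operators in `S_{·,b}`. -/
def encCoeff (b : Fin 2) : Fin 3 → ℂ :=
  if b = 0 then ![-(s3 / 3), (s3 + 3) / 6, (s3 - 3) / 6]
  else ![-(s3 / 3), (s3 - 3) / 6, (s3 + 3) / 6]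

theorem star_encCoeff (b : Fin 2) (k : Fin 3) : star (encCoeff b k) = encCoeff b k := by
  have h := star_s3
  simp only [Complex.star_def] at h
  fin_cases b <;> fin_cases k <;> simp [encCoeff, h]

theorem Senc_eq (k1 k2 k3 : Fin 9) (b : Fin 2) :
    Senc k1 k2 k3 b =
      encCoeff b 0 • ad k1 + encCoeff b 1 • ad k2 + encCoeff b 2 • ad k3 := by
  have h0 : s3 ≠ 0 := fun h => by simpa [h] using s3_mul_self
  have hinv : 1 / (2 * s3) = s3 / 6 := by
    field_simp
    linear_combination -2 * s3_mul_self
  have h := s3_mul_self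
  rw [Senc, hinv]
  fin_cases b
  · simp only [encCoeff, Fin.zero_eta, if_true, cons_val]
    match_scalars <;>
      first | ring1 | linear_combination (1 / 6) * h | linear_combination (-1 / 6) * h
  · simp [encCoeff]
    match_scalars <;>
      first | ring1 | linear_combination (1 / 6) * h | linear_combination (-1 / 6) * h

theorem enc_eq (b b' : Fin 2) :
    enc b b' =
      encCoeff b 0 • (encCoeff b' 0 • pairState 0 3 + encCoeff b' 1 • pairState 0 4
        + encCoeff b' 2 • pairState 0 5)
      + encCoeff b 1 • (encCoeff b' 0 • pairState 1 3 + encCoeff b' 1 • pairState 1 4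
        + encCoeff b' 2 • pairState 1 5)
      + encCoeff b 2 • (encCoeff b' 0 • pairState 2 3 + encCoeff b' 1 • pairState 2 4
        + encCoeff b' 2 • pairState 2 5) := by
  rw [enc, Senc_eq, Senc_eq, ← mulVec_mulVec]
  simp only [add_mulVec, smul_mulVec, mulVec_add, mulVec_smul, pairState]
  module

theorem V2_mulVec_enc (b b' : Fin 2) :
    V2 *ᵥ enc b b' =
      encCoeff b 0 • (encCoeff b' 0 • pairState 8 3 + encCoeff b' 1 • pairState 8 4
        + encCoeff b' 2 • pairState 8 5)
      + encCoeff b' 0 • (encCoeff b 0 • pairState 0 8 + encCoeff b 1 • pairState 1 8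
        + encCoeff b 2 • pairState 2 8) := by
  rw [enc_eq, V2]
  simp only [add_mulVec, mulVec_add, mulVec_smul, hop_mulVec_pairState, Fin.reduceEq, if_true,
    if_false, add_zero, zero_add, smul_zero]
  module

/-- The first-order response: the solution in the range of `Pip` of
`Pic H₀ Pic w = Pic V₂ |bb'⟩`. -/
def response (b b' : Fin 2) : Idx → ℂ :=
  encCoeff b 0 • (((2 * encCoeff b' 1 - encCoeff b' 2) / 3) • pairState 8 4
    + ((2 * encCoeff b' 2 - encCoeff b' 1) / 3) • pairState 8 5)
  + encCoeff b' 0 • (((2 * encCoeff b 1 - encCoeff b 2) / 3) • pairState 1 8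
    + ((2 * encCoeff b 2 - encCoeff b 1) / 3) • pairState 2 8)

theorem Pic_mulVec_pairState_of_indep {k l : Fin 9}
    (h : IndepSet {k, l} ∧ ({k, l} : Finset (Fin 9)).card = 2) :
    Pic *ᵥ pairState k l = pairState k l := by
  rw [Pic_mulVec_pairState, if_pos h]

theorem Pic_mulVec_pairState_of_not_indep {k l : Fin 9} (h : ¬ IndepSet {k, l}) :
    Pic *ᵥ pairState k l = 0 := by
  rw [Pic_mulVec_pairState, if_neg fun h' => h h'.1]

theorem Pic_mulVec_enc (b b' : Fin 2) : Pic *ᵥ enc b b' = enc b b' := by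
  rw [enc_eq]
  simp only [mulVec_add, mulVec_smul]
  repeat rw [Pic_mulVec_pairState_of_indep (by decide)]

theorem Pic_mulVec_response (b b' : Fin 2) : Pic *ᵥ response b b' = response b b' := by
  rw [response]
  simp only [mulVec_add, mulVec_smul]
  repeat rw [Pic_mulVec_pairState_of_indep (by decide)]

theorem H0_mulVec_response (b b' : Fin 2) :
    Pic *ᵥ (H0 *ᵥ response b b') = Pic *ᵥ (V2 *ᵥ enc b b') := by
  rw [V2_mulVec_enc, response, H0, H0i, H0j]
  simp only [add_mulVec, mulVec_add, mulVec_smul, one_mulVec, hop_mulVec_pairState,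
    Fin.reduceEq, if_true, if_false, add_zero, zero_add]
  rw [Pic_mulVec_pairState_of_not_indep (k := 8) (l := 3) (by decide),
    Pic_mulVec_pairState_of_not_indep (k := 0) (l := 8) (by decide)]
  module

theorem star_enc_dotProduct_response (b b' d d' : Fin 2) :
    star (enc b b') ⬝ᵥ response d d' = 0 := by
  rw [response, enc_eq]
  simp [star_pairState_dotProduct, Fin.reduceEq]

theorem V2_mulVec_response (b b' : Fin 2) :
    V2 *ᵥ response b b' =
      encCoeff b 0 • (((2 * encCoeff b' 1 - encCoeff b' 2) / 3) • (pairState 0 4 + pairState 3 4)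
        + ((2 * encCoeff b' 2 - encCoeff b' 1) / 3) • (pairState 0 5 + pairState 3 5))
      + encCoeff b' 0 • (((2 * encCoeff b 1 - encCoeff b 2) / 3) • (pairState 1 0 + pairState 1 3)
        + ((2 * encCoeff b 2 - encCoeff b 1) / 3) • (pairState 2 0 + pairState 2 3)) := by
  rw [response, V2]
  simp only [add_mulVec, mulVec_add, mulVec_smul, hop_mulVec_pairState, Fin.reduceEq, if_true,
    if_false, add_zero, zero_add]

theorem star_enc_dotProduct_V2_mulVec_response (b b' d d' : Fin 2) :
    star (enc b b') ⬝ᵥ (V2 *ᵥ response d d') =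
      encCoeff b 0 * encCoeff d 0 *
        (encCoeff b' 1 * ((2 * encCoeff d' 1 - encCoeff d' 2) / 3)
          + encCoeff b' 2 * ((2 * encCoeff d' 2 - encCoeff d' 1) / 3))
      + encCoeff b' 0 * encCoeff d' 0 *
        (encCoeff b 1 * ((2 * encCoeff d 1 - encCoeff d 2) / 3)
          + encCoeff b 2 * ((2 * encCoeff d 2 - encCoeff d 1) / 3)) := by
  rw [V2_mulVec_response, enc_eq]
  simp only [star_add, star_smul, star_encCoeff, add_dotProduct, smul_dotProduct, dotProduct_add,
    dotProduct_smul, star_pairState_dotProduct, Fin.reduceEq, and_true, and_false, and_self,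
    if_true, if_false, smul_eq_mul]
  ring

/-- The matrix whose columns are the first-order responses. -/
def responseMatrix : Matrix Idx (Fin 2 × Fin 2) ℂ := of fun t p => response p.1 p.2 t

theorem mul_Eenc_apply (M : Mat) (t : Idx) (p : Fin 2 × Fin 2) :
    (M * Eenc) t p = (M *ᵥ enc p.1 p.2) t := rfl

theorem mul_responseMatrix_apply (M : Mat) (t : Idx) (p : Fin 2 × Fin 2) :
    (M * responseMatrix) t p = (M *ᵥ response p.1 p.2) t := rfl

theorem Pic_mul_Eenc : Pic * Eenc = Eenc := by
  ext t p
  rw [mul_Eenc_apply, Pic_mulVec_enc]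
  rfl

theorem Pic_mul_responseMatrix : Pic * responseMatrix = responseMatrix := by
  ext t p
  rw [mul_responseMatrix_apply, Pic_mulVec_response]
  rfl

theorem Pic_conjTranspose : Picᴴ = Pic := by
  rw [Pic, diagonal_conjTranspose]
  congr 1
  ext t
  simp only [Pi.star_apply]
  split_ifs <;> simp

theorem Pic_mul_Pic : Pic * Pic = Pic := by
  rw [Pic, diagonal_mul_diagonal]
  congr 1
  ext t
  split_ifs <;> simp

theorem Eenc_conjTranspose_mul_Pic : Eencᴴ * Pic = Eencᴴ := by
  rw [← Pic_conjTranspose, ← conjTranspose_mul, Pic_mul_Eenc]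

theorem Eenc_conjTranspose_mul_responseMatrix : Eencᴴ * responseMatrix = 0 := by
  ext p q
  exact star_enc_dotProduct_response p.1 p.2 q.1 q.2

theorem Pic_mul_H0_mul_responseMatrix :
    Pic * (H0 * responseMatrix) = Pic * (V2 * Eenc) := by
  ext t p
  exact congrFun (H0_mulVec_response p.1 p.2) t

theorem Pip_mul_responseMatrix : Pip * responseMatrix = responseMatrix := by
  rw [Pip, Pim, Matrix.sub_mul, Matrix.mul_assoc, Eenc_conjTranspose_mul_responseMatrix,
    Matrix.mul_zero, sub_zero, Pic_mul_responseMatrix]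

theorem Pip_mul_Pic : Pip * Pic = Pip := by
  rw [Pip, Pim, Matrix.sub_mul, Pic_mul_Pic, Matrix.mul_assoc, Eenc_conjTranspose_mul_Pic]

theorem mul_V2_mul_Eenc {G : Mat} (hG : G = Pip * G * Pip)
    (hGinv : G * (Pic * H0 * Pic) * Pip = Pip) : G * (V2 * Eenc) = responseMatrix := by
  have hGP : G * Pic = G := by
    rw [hG, Matrix.mul_assoc, Pip_mul_Pic]
  calc G * (V2 * Eenc) = G * (Pic * (H0 * (Pic * (Pip * responseMatrix)))) := by
        rw [Pip_mul_responseMatrix, Pic_mul_responseMatrix, Pic_mul_H0_mul_responseMatrix,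
          ← Matrix.mul_assoc G Pic, hGP]
    _ = G * (Pic * H0 * Pic) * Pip * responseMatrix := by simp only [Matrix.mul_assoc]
    _ = responseMatrix := by rw [hGinv, Pip_mul_responseMatrix]


/-!
STATEMENT 5: The second-order effective interaction of `V₂` on the encoded
qubits: `−E† V₂ G V₂ E = (1/27)(−10·I₄ + 8·X⊗X − X⊗I₂ − I₂⊗X)` for any `G`
with `G = Π₊ G Π₊` and `G (Π_c H₀ Π_c) Π₊ = Π₊`.
-/

theorem statement5 (G : Mat) (hG : G = Pip * G * Pip)
    (hGinv : G * (Pic * H0 * Pic) * Pip = Pip) :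
    -(Eencᴴ * V2 * G * V2 * Eenc) =
      (1 / 27 : ℂ) •
        ((-10 : ℂ) • (1 : Matrix (Fin 2 × Fin 2) (Fin 2 × Fin 2) ℂ)
          + (8 : ℂ) • (PX ⊗ₖ PX)
          - PX ⊗ₖ (1 : Matrix (Fin 2) (Fin 2) ℂ)
          - (1 : Matrix (Fin 2) (Fin 2) ℂ) ⊗ₖ PX) := by
  rw [Matrix.mul_assoc, Matrix.mul_assoc, Matrix.mul_assoc, mul_V2_mul_Eenc hG hGinv]
  ext ⟨b, b'⟩ ⟨d, d'⟩
  have key : (Eencᴴ * (V2 * responseMatrix)) (b, b') (d, d') = _ :=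
    star_enc_dotProduct_V2_mulVec_response b b' d d'
  have h2 : s3 ^ 2 = 3 := by rw [sq, s3_mul_self]
  have h4 : s3 ^ 4 = 9 := by linear_combination (s3 ^ 2 + 3) * h2
  rw [Matrix.neg_apply, key]
  fin_cases b <;> fin_cases b' <;> fin_cases d <;> fin_cases d' <;>
    simp [encCoeff, PX, kroneckerMap_apply] <;> ring_nf <;>
    simp only [h2, h4] <;> norm_num

end
end

section
/- In the Laplacian gadget, the states ψ± := (1/√2) a_x†(a_{j1}† ± a_{j3}†)|vac⟩ lie in the two-particle constrained subspace and are eigenvectors of Π_c H₀' Π_c with eigenvalues 4 (for ψ₊) and 2 (for ψ₋). -/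
open Matrix
open scoped Kronecker

noncomputable section

/-- `P_k = ∏_{l : {k,l} ∈ E(G_c)} (I − n_l)`, the product over the neighbours of
`k` in the constraint graph (the factors pairwise commute, so the product is
taken over the neighbours listed in increasing order). -/
def Pk (k : Fin 9) : Mat :=
  ((((Finset.univ.filter fun l => Adj k l)).sort (· ≤ ·)).map
    fun l => (1 : Mat) - ad l * a l).prod

/-- The Laplacian-gadget unperturbed Hamiltonian
`H₀' = (a_{i1}†a_{i2}+h.c.) + (a_{i2}†a_{i3}+h.c.) + (a_{i3}†a_{i1}+h.c.)
     + (a_{j1}†a_{j2}+h.c.) + (a_{j2}†a_{j3}+h.c.) + (a_{j3}†a_{j1}+h.c.)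
     + P_{i1} + P_{i2} + P_{i3} + P_{j1} + P_{j2} + P_{j3}`. -/
def H0' : Mat :=
  (ad 0 * a 1 + ad 1 * a 0) + (ad 1 * a 2 + ad 2 * a 1) + (ad 2 * a 0 + ad 0 * a 2)
    + (ad 3 * a 4 + ad 4 * a 3) + (ad 4 * a 5 + ad 5 * a 4) + (ad 5 * a 3 + ad 3 * a 5)
    + Pk 0 + Pk 1 + Pk 2 + Pk 3 + Pk 4 + Pk 5

/-- `√2` as a complex number. -/
def s2 : ℂ := (Real.sqrt 2 : ℝ)

/-- `ψ₊ = (1/√2) a_x†(a_{j1}† + a_{j3}†)|vac⟩`. -/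
def psiP : Idx → ℂ := ((1 / s2) • (ad 6 * (ad 3 + ad 5))).mulVec vac

/-- `ψ₋ = (1/√2) a_x†(a_{j1}† − a_{j3}†)|vac⟩`. -/
def psiM : Idx → ℂ := ((1 / s2) • (ad 6 * (ad 3 - ad 5))).mulVec vac

lemma a_mulVec_fock (k : Fin 9) (S : Finset (Fin 9)) :
    (a k).mulVec (fock S) =
      if k ∈ S then (-1 : ℂ) ^ (S.filter (· < k)).card • fock (S.erase k) else 0 := by
  ext s
  have hcard : (Finset.univ.filter fun l => l < k ∧ l ∈ S) = S.filter (· < k) := by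
    ext l; simp [and_comm]
  have hupd : Function.update (fun l => decide (l ∈ S)) k false =
      fun l => decide (l ∈ S.erase k) := by
    ext l; by_cases h : l = k <;> simp [Function.update, h]
  simp only [mulVec, dotProduct, fock, a, of_apply, mul_ite, mul_one, mul_zero,
    Finset.sum_ite_eq', Finset.mem_univ, if_true, decide_eq_true_eq, hcard, hupd]
  by_cases hk : k ∈ S <;> simp [hk, fock]

lemma ad_mulVec_fock (k : Fin 9) (S : Finset (Fin 9)) :
    (ad k).mulVec (fock S) =
      if k ∈ S then 0 else (-1 : ℂ) ^ (S.filter (· < k)).card • fock (insert k S) := by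
  ext s
  simp only [mulVec, dotProduct, fock, ad, a, conjTranspose_apply, of_apply, mul_ite, mul_one,
    mul_zero, Finset.sum_ite_eq', Finset.mem_univ, if_true]
  by_cases hk : k ∈ S
  · have : ¬ (s k = true ∧ (fun l => decide (l ∈ S)) = Function.update s k false) := by
      rintro ⟨-, h⟩
      simpa [hk] using congrFun h k
    simp [hk, this]
  · have hiff : (s k = true ∧ (fun l => decide (l ∈ S)) = Function.update s k false) ↔
        s = fun l => decide (l ∈ insert k S) := by
      constructor
      · rintro ⟨hs, h⟩
        ext l
        have := congrFun h l
        by_cases hl : l = k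
        · subst hl; simp [hs]
        · simpa [Function.update, hl] using this.symm
      · rintro rfl
        refine ⟨by simp, ?_⟩
        ext l
        by_cases hl : l = k
        · subst hl; simp [hk]
        · simp [Function.update, hl]
    by_cases hs : s = fun l => decide (l ∈ insert k S)
    · have hcard : (Finset.univ.filter fun l => l < k ∧ s l = true) = S.filter (· < k) := by
        ext l
        simp only [hs, Finset.mem_filter, Finset.mem_univ, true_and, decide_eq_true_eq,
          Finset.mem_insert]
        constructor
        · rintro ⟨h, rfl | h'⟩
          · exact absurd h (lt_irrefl _)
          · exact ⟨h', h⟩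
        · rintro ⟨h, h'⟩
          exact ⟨h', Or.inr h⟩
      rw [if_pos (hiff.2 hs), hcard]
      simp [hk, fock, hs]
    · rw [if_neg (mt hiff.1 hs)]
      simp only [hk, if_false, Pi.smul_apply, fock, if_neg hs, star_zero, smul_zero]

lemma one_sub_number_mulVec_fock (l : Fin 9) (S : Finset (Fin 9)) :
    ((1 : Mat) - ad l * a l).mulVec (fock S) = if l ∈ S then 0 else fock S := by
  rw [sub_mulVec, one_mulVec, ← mulVec_mulVec, a_mulVec_fock]
  by_cases h : l ∈ S
  · have hf : (S.erase l).filter (· < l) = S.filter (· < l) := by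
      ext m
      simp only [Finset.mem_filter, Finset.mem_erase]
      exact ⟨fun h => ⟨h.1.2, h.2⟩, fun h => ⟨⟨h.2.ne, h.1⟩, h.2⟩⟩
    simp [h, mulVec_smul, ad_mulVec_fock, hf, smul_smul, ← mul_pow]
  · simp [h]

lemma prod_one_sub_number_mulVec_fock (L : List (Fin 9)) (S : Finset (Fin 9)) :
    (L.map fun l => (1 : Mat) - ad l * a l).prod.mulVec (fock S) =
      if ∀ l ∈ L, l ∉ S then fock S else 0 := by
  induction L with
  | nil => simp
  | cons m L ih =>
    rw [List.map_cons, List.prod_cons, ← mulVec_mulVec, ih]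
    by_cases hL : ∀ l ∈ L, l ∉ S
    · rw [if_pos hL, one_sub_number_mulVec_fock]
      by_cases hm : m ∈ S
      · simp [hm]
      · simp only [hm, if_false, List.forall_mem_cons, not_false_eq_true, true_and, if_pos hL]
    · simp only [hL, if_false, List.forall_mem_cons, and_false, mulVec_zero]

lemma Pk_mulVec_fock (k : Fin 9) (S : Finset (Fin 9)) :
    (Pk k).mulVec (fock S) = if ∀ l, Adj k l → l ∉ S then fock S else 0 := by
  rw [Pk, prod_one_sub_number_mulVec_fock]
  simp

lemma Pic_mulVec_fock (S : Finset (Fin 9)) :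
    Pic.mulVec (fock S) = if IndepSet S ∧ S.card = 2 then fock S else 0 := by
  ext t
  rw [Pic, mulVec_diagonal]
  by_cases ht : t = fun k => decide (k ∈ S)
  · have hS : suppOf t = S := by ext k; simp [suppOf, ht]
    rw [hS]
    split_ifs <;> simp
  · have h0 : fock S t = 0 := if_neg ht
    rw [h0, mul_zero]
    split_ifs
    · exact h0.symm
    · rfl

lemma vac_eq_fock : vac = fock ∅ := by
  ext t
  simp [vac, fock]

lemma ad_ad_mulVec_vac {k l : Fin 9} (h : k < l) :
    (ad l * ad k).mulVec vac = -fock {l, k} := by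
  have hf : ({k} : Finset (Fin 9)).filter (· < l) = {k} := by
    simp [Finset.filter_singleton, h]
  rw [vac_eq_fock, ← mulVec_mulVec, ad_mulVec_fock]
  simp [ad_mulVec_fock, h.ne', hf]

lemma psiP_eq : psiP = -(1 / s2) • (fock {6, 3} + fock {6, 5}) := by
  rw [psiP, smul_mulVec, mul_add, add_mulVec, ad_ad_mulVec_vac (by decide),
    ad_ad_mulVec_vac (by decide)]
  module

lemma psiM_eq : psiM = -(1 / s2) • (fock {6, 3} - fock {6, 5}) := by
  rw [psiM, smul_mulVec, mul_sub, sub_mulVec, ad_ad_mulVec_vac (by decide),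
    ad_ad_mulVec_vac (by decide)]
  module

lemma fock_mem_C2 {S : Finset (Fin 9)} (hS : IndepSet S) (hcard : S.card = 2) : fock S ∈ C2 :=
  Submodule.subset_span ⟨S, hS, hcard, rfl⟩

lemma fock_apply_indicator (S T : Finset (Fin 9)) :
    fock S (fun k => decide (k ∈ T)) = if T = S then 1 else 0 := by
  have h : ((fun k => decide (k ∈ T)) = fun k => decide (k ∈ S)) ↔ T = S := by
    simp [funext_iff, Finset.ext_iff]
  simp only [fock, h]

lemma s2_ne_zero : s2 ≠ 0 := by
  simp [s2]

lemma H0'_mulVec_fock_x_j1 :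
    H0'.mulVec (fock {6, 3}) = (3 : ℂ) • fock {6, 3} + fock {6, 4} + fock {6, 5} := by
  have h4 : insert 4 (({6, 3} : Finset (Fin 9)).erase 3) = {6, 4} := by decide
  have h5 : insert 5 (({6, 3} : Finset (Fin 9)).erase 3) = {6, 5} := by decide
  have c : (({6, 3} : Finset (Fin 9)).filter (· < 3)).card = 0 := by decide
  have c4 : ((({6, 3} : Finset (Fin 9)).erase 3).filter (· < 4)).card = 0 := by decide
  have c5 : ((({6, 3} : Finset (Fin 9)).erase 3).filter (· < 5)).card = 0 := by decide
  simp +decide only [H0', add_mulVec, ← mulVec_mulVec, a_mulVec_fock, Pk_mulVec_fock, if_true,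
    if_false, mulVec_zero, ad_mulVec_fock, h4, h5, c, c4, c5, pow_zero, one_smul]
  module

lemma H0'_mulVec_fock_x_j3 :
    H0'.mulVec (fock {6, 5}) = (3 : ℂ) • fock {6, 5} + fock {6, 4} + fock {6, 3} := by
  have h4 : insert 4 (({6, 5} : Finset (Fin 9)).erase 5) = {6, 4} := by decide
  have h3 : insert 3 (({6, 5} : Finset (Fin 9)).erase 5) = {6, 3} := by decide
  have c : (({6, 5} : Finset (Fin 9)).filter (· < 5)).card = 0 := by decide
  have c4 : ((({6, 5} : Finset (Fin 9)).erase 5).filter (· < 4)).card = 0 := by decide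
  have c3 : ((({6, 5} : Finset (Fin 9)).erase 5).filter (· < 3)).card = 0 := by decide
  simp +decide only [H0', add_mulVec, ← mulVec_mulVec, a_mulVec_fock, Pk_mulVec_fock, if_true,
    if_false, mulVec_zero, ad_mulVec_fock, h4, h3, c, c4, c3, pow_zero, one_smul]
  module

lemma compression_mulVec_fock_x_j1 :
    (Pic * H0' * Pic).mulVec (fock {6, 3}) = (3 : ℂ) • fock {6, 3} + fock {6, 5} := by
  rw [← mulVec_mulVec, ← mulVec_mulVec, Pic_mulVec_fock, if_pos (by decide), H0'_mulVec_fock_x_j1]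
  simp only [mulVec_add, mulVec_smul, Pic_mulVec_fock]
  rw [if_pos (by decide), if_neg (by decide), if_pos (by decide), add_zero]

lemma compression_mulVec_fock_x_j3 :
    (Pic * H0' * Pic).mulVec (fock {6, 5}) = (3 : ℂ) • fock {6, 5} + fock {6, 3} := by
  rw [← mulVec_mulVec, ← mulVec_mulVec, Pic_mulVec_fock, if_pos (by decide), H0'_mulVec_fock_x_j3]
  simp only [mulVec_add, mulVec_smul, Pic_mulVec_fock]
  rw [if_pos (by decide), if_neg (by decide), if_pos (by decide), add_zero]

/-!
STATEMENT 14: In the Laplacian gadget, `ψ±` lie in the two-particle constrained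
subspace and are eigenvectors of `Π_c H₀' Π_c` with eigenvalues 4 (for `ψ₊`)
and 2 (for `ψ₋`).
-/

theorem statement14 :
    psiP ∈ C2 ∧ psiM ∈ C2 ∧ psiP ≠ 0 ∧ psiM ≠ 0 ∧
    (Pic * H0' * Pic).mulVec psiP = (4 : ℂ) • psiP ∧
    (Pic * H0' * Pic).mulVec psiM = (2 : ℂ) • psiM := by
  have h3 : fock {6, 3} ∈ C2 := fock_mem_C2 (by decide) (by decide)
  have h5 : fock {6, 5} ∈ C2 := fock_mem_C2 (by decide) (by decide)
  have hne : ({6, 3} : Finset (Fin 9)) ≠ {6, 5} := by decide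
  rw [psiP_eq, psiM_eq]
  refine ⟨C2.smul_mem _ (C2.add_mem h3 h5), C2.smul_mem _ (C2.sub_mem h3 h5), ?_, ?_, ?_, ?_⟩
  · intro h
    have := congrFun h fun k => decide (k ∈ ({6, 3} : Finset (Fin 9)))
    rw [Pi.smul_apply, Pi.add_apply, fock_apply_indicator, fock_apply_indicator, if_pos rfl,
      if_neg hne] at this
    simp [s2_ne_zero] at this
  · intro h
    have := congrFun h fun k => decide (k ∈ ({6, 3} : Finset (Fin 9)))
    rw [Pi.smul_apply, Pi.sub_apply, fock_apply_indicator, fock_apply_indicator, if_pos rfl,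
      if_neg hne] at this
    simp [s2_ne_zero] at this
  · rw [mulVec_smul, mulVec_add, compression_mulVec_fock_x_j1, compression_mulVec_fock_x_j3]
    module
  · rw [mulVec_smul, mulVec_sub, compression_mulVec_fock_x_j1, compression_mulVec_fock_x_j3]
    module

end
end
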